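/- Let Γ be a finitely generated group and H a subgroup of Γ of finite index. Then the stabilizer Stab(H) = {σ ∈ Aut(Γ) : σ(H) = H} is a subgroup of finite index in the automorphism group Aut(Γ). -/

import Mathlib

open Pointwise

/-- Let `Γ` be a finitely generated group and `H ≤ Γ` a subgroup of
finite index. Then the stabilizer `Stab(H) = {σ ∈ Aut(Γ) : σ(H) = H}` (the stabilizer
of `H` under the pointwise action of `MulAut Γ` on subgroups, so `σ • H = σ(H)`) has
finite index in the automorphism group `Aut(Γ) = MulAut Γ`. -/
theorem stabilizer_finiteIndex_of_finiteIndex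
    {Γ : Type*} [Group Γ] [Group.FG Γ] (H : Subgroup Γ) (hH : H.FiniteIndex) :
    (MulAction.stabilizer (MulAut Γ) H).FiniteIndex := by
  have hQ : Finite (Γ ⧸ H) := Subgroup.finite_quotient_of_finiteIndex
  obtain ⟨S, hS⟩ := Group.fg_def.mp (inferInstance : Group.FG Γ)
  have hF : Finite (Γ →* Equiv.Perm (Γ ⧸ H)) := by
    refine Finite.of_injective
      (fun (f : Γ →* Equiv.Perm (Γ ⧸ H)) (s : (S : Set Γ)) => f s) ?_
    intro f g hfg
    refine MonoidHom.eq_of_eqOn_dense hS ?_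
    intro x hx
    exact congrFun hfg ⟨x, hx⟩
  have horb : (MulAction.orbit (MulAut Γ) H).Finite := by
    refine (Set.finite_range (fun f : Γ →* Equiv.Perm (Γ ⧸ H) =>
      (MulAction.stabilizer (Equiv.Perm (Γ ⧸ H)) ((1 : Γ) : Γ ⧸ H)).comap f)).subset ?_
    rintro _ ⟨σ, rfl⟩
    refine ⟨(MulAction.toPermHom Γ (Γ ⧸ H)).comp (σ⁻¹ : MulAut Γ).toMonoidHom, ?_⟩
    ext x
    have h : x ∈ σ • H ↔ σ⁻¹ • x ∈ H := Subgroup.mem_pointwise_smul_iff_inv_smul_mem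
    refine Iff.trans ?_ h.symm
    change (((σ⁻¹ • x) * 1 : Γ) : Γ ⧸ H) = ((1 : Γ) : Γ ⧸ H) ↔ _
    rw [mul_one, eq_comm, QuotientGroup.eq]
    simp
  refine ⟨?_⟩
  rw [MulAction.index_stabilizer]
  exact (Set.ncard_pos horb).mpr ⟨H, MulAction.mem_orbit_self H⟩ |>.ne'
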